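/- Let R be a polarized rewrite system such that no atomic proposition is both the left-hand side of a negative rule and the left-hand side of a positive rule. Then every proof-term π of Γ ⊢_R A in polarized natural deduction modulo R is strongly normalizable. -/

import Mathlib

/-- Propositional formulas: atoms (indexed by naturals), ⊥, ⇒, ∧, ∨. -/
inductive Form : Type where
  | atom : ℕ → Form
  | bot  : Form
  | imp  : Form → Form → Form
  | and  : Form → Form → Form
  | or   : Form → Form → Form

/-- A polarized rewrite system: a set of negative rules and a set of positive
rules, each rewriting an atomic proposition to an arbitrary formula. -/
structure PRS : Type where
  neg : ℕ → Form → Prop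
  pos : ℕ → Form → Prop

mutual
  /-- One step negative rewriting →₋¹. -/
  inductive Neg1 (R : PRS) : Form → Form → Prop where
    | rule {P A} : R.neg P A → Neg1 R (.atom P) A
    | impL {A A' B} : Pos1 R A A' → Neg1 R (.imp A B) (.imp A' B)
    | impR {A B B'} : Neg1 R B B' → Neg1 R (.imp A B) (.imp A B')
    | andL {A A' B} : Neg1 R A A' → Neg1 R (.and A B) (.and A' B)
    | andR {A B B'} : Neg1 R B B' → Neg1 R (.and A B) (.and A B')
    | orL  {A A' B} : Neg1 R A A' → Neg1 R (.or A B) (.or A' B)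
    | orR  {A B B'} : Neg1 R B B' → Neg1 R (.or A B) (.or A B')
  /-- One step positive rewriting →₊¹. -/
  inductive Pos1 (R : PRS) : Form → Form → Prop where
    | rule {P A} : R.pos P A → Pos1 R (.atom P) A
    | impL {A A' B} : Neg1 R A A' → Pos1 R (.imp A B) (.imp A' B)
    | impR {A B B'} : Pos1 R B B' → Pos1 R (.imp A B) (.imp A B')
    | andL {A A' B} : Pos1 R A A' → Pos1 R (.and A B) (.and A' B)
    | andR {A B B'} : Pos1 R B B' → Pos1 R (.and A B) (.and A B')
    | orL  {A A' B} : Pos1 R A A' → Pos1 R (.or A B) (.or A' B)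
    | orR  {A B B'} : Pos1 R B B' → Pos1 R (.or A B) (.or A B')
end

/-- →₋ : reflexive-transitive closure of →₋¹. -/
def NegR (R : PRS) : Form → Form → Prop := Relation.ReflTransGen (Neg1 R)

/-- →₊ : reflexive-transitive closure of →₊¹. -/
def PosR (R : PRS) : Form → Form → Prop := Relation.ReflTransGen (Pos1 R)

/-- The relations →₋ and →₊ commute. -/
def Commutes (R : PRS) : Prop :=
  ∀ A B C, NegR R B A → PosR R B C → ∃ D, PosR R A D ∧ NegR R C D

/-- Proof-terms (de Bruijn representation of the proof variables). -/
inductive PTerm : Type where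
  | var  : ℕ → PTerm
  | lam  : PTerm → PTerm
  | app  : PTerm → PTerm → PTerm
  | pair : PTerm → PTerm → PTerm
  | fst  : PTerm → PTerm
  | snd  : PTerm → PTerm
  | inl  : PTerm → PTerm
  | inr  : PTerm → PTerm
  | case : PTerm → PTerm → PTerm → PTerm
  | exf  : PTerm → PTerm

/-- Shift by one all de Bruijn indices ≥ c. -/
def liftAbove (c : ℕ) : PTerm → PTerm
  | .var n => if n < c then .var n else .var (n+1)
  | .lam π => .lam (liftAbove (c+1) π)
  | .app a b => .app (liftAbove c a) (liftAbove c b)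
  | .pair a b => .pair (liftAbove c a) (liftAbove c b)
  | .fst a => .fst (liftAbove c a)
  | .snd a => .snd (liftAbove c a)
  | .inl a => .inl (liftAbove c a)
  | .inr a => .inr (liftAbove c a)
  | .case a b c' => .case (liftAbove c a) (liftAbove (c+1) b) (liftAbove (c+1) c')
  | .exf a => .exf (liftAbove c a)

/-- Substitution [u/k]π of the term u for the variable k. -/
def subst (k : ℕ) (u : PTerm) : PTerm → PTerm
  | .var n => if n < k then .var n else if n = k then u else .var (n-1)
  | .lam π => .lam (subst (k+1) (liftAbove 0 u) π)
  | .app a b => .app (subst k u a) (subst k u b)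
  | .pair a b => .pair (subst k u a) (subst k u b)
  | .fst a => .fst (subst k u a)
  | .snd a => .snd (subst k u a)
  | .inl a => .inl (subst k u a)
  | .inr a => .inr (subst k u a)
  | .case a b c => .case (subst k u a) (subst (k+1) (liftAbove 0 u) b) (subst (k+1) (liftAbove 0 u) c)
  | .exf a => .exf (subst k u a)

/-- Typing judgement of polarized natural deduction modulo R:
`Typed R Γ π A` means "π is a proof-term of Γ ⊢_R A".
A context is a finite list of formulas (the declaration of variable n is the
n-th entry of the list). -/
inductive Typed (R : PRS) : List Form → PTerm → Form → Prop where
  | ax {Γ n A B C} : Γ[n]? = some A → NegR R A C → PosR R B C →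
      Typed R Γ (.var n) B
  | impI {Γ π A B C} : Typed R (A :: Γ) π B → PosR R C (.imp A B) →
      Typed R Γ (.lam π) C
  | impE {Γ π₁ π₂ A B C} : Typed R Γ π₁ C → NegR R C (.imp A B) →
      Typed R Γ π₂ A → Typed R Γ (.app π₁ π₂) B
  | andI {Γ π₁ π₂ A B C} : Typed R Γ π₁ A → Typed R Γ π₂ B →
      PosR R C (.and A B) → Typed R Γ (.pair π₁ π₂) C
  | andE₁ {Γ π A B C} : Typed R Γ π C → NegR R C (.and A B) →
      Typed R Γ (.fst π) A
  | andE₂ {Γ π A B C} : Typed R Γ π C → NegR R C (.and A B) →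
      Typed R Γ (.snd π) B
  | orI₁ {Γ π A B C} : Typed R Γ π A → PosR R C (.or A B) →
      Typed R Γ (.inl π) C
  | orI₂ {Γ π A B C} : Typed R Γ π B → PosR R C (.or A B) →
      Typed R Γ (.inr π) C
  | orE {Γ π₁ π₂ π₃ A B C D} : Typed R Γ π₁ D → NegR R D (.or A B) →
      Typed R (A :: Γ) π₂ C → Typed R (B :: Γ) π₃ C →
      Typed R Γ (.case π₁ π₂ π₃) C
  | botE {Γ π A B} : Typed R Γ π B → NegR R B .bot →
      Typed R Γ (.exf π) A

/-- One step proof reduction ▷¹ (contextual closure of the cut elimination rules). -/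
inductive Red1 : PTerm → PTerm → Prop where
  | beta {π₁ π₂} : Red1 (.app (.lam π₁) π₂) (subst 0 π₂ π₁)
  | fstPair {π₁ π₂} : Red1 (.fst (.pair π₁ π₂)) π₁
  | sndPair {π₁ π₂} : Red1 (.snd (.pair π₁ π₂)) π₂
  | caseInl {π₁ π₂ π₃} : Red1 (.case (.inl π₁) π₂ π₃) (subst 0 π₁ π₂)
  | caseInr {π₁ π₂ π₃} : Red1 (.case (.inr π₁) π₂ π₃) (subst 0 π₁ π₃)
  | lam {π π'} : Red1 π π' → Red1 (.lam π) (.lam π')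
  | appL {π π' ρ} : Red1 π π' → Red1 (.app π ρ) (.app π' ρ)
  | appR {π ρ ρ'} : Red1 ρ ρ' → Red1 (.app π ρ) (.app π ρ')
  | pairL {π π' ρ} : Red1 π π' → Red1 (.pair π ρ) (.pair π' ρ)
  | pairR {π ρ ρ'} : Red1 ρ ρ' → Red1 (.pair π ρ) (.pair π ρ')
  | fst {π π'} : Red1 π π' → Red1 (.fst π) (.fst π')
  | snd {π π'} : Red1 π π' → Red1 (.snd π) (.snd π')
  | inl {π π'} : Red1 π π' → Red1 (.inl π) (.inl π')
  | inr {π π'} : Red1 π π' → Red1 (.inr π) (.inr π')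
  | case₁ {π π' ρ τ} : Red1 π π' → Red1 (.case π ρ τ) (.case π' ρ τ)
  | case₂ {π ρ ρ' τ} : Red1 ρ ρ' → Red1 (.case π ρ τ) (.case π ρ' τ)
  | case₃ {π ρ τ τ'} : Red1 τ τ' → Red1 (.case π ρ τ) (.case π ρ τ')
  | exf {π π'} : Red1 π π' → Red1 (.exf π) (.exf π')

/-- ▷ : reflexive-transitive closure of ▷¹. -/
def Red : PTerm → PTerm → Prop := Relation.ReflTransGen Red1

/-- A proof-term is strongly normalizable if every ▷¹-reduction sequence from
it is finite, i.e. it is accessible for the inverse of ▷¹. -/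
def SN (π : PTerm) : Prop := Acc (fun x y => Red1 y x) π

/-- Neutral proof-terms: variables and eliminations, not introductions. -/
def Neutral : PTerm → Prop
  | .var _ => True
  | .app _ _ => True
  | .fst _ => True
  | .snd _ => True
  | .case _ _ _ => True
  | .exf _ => True
  | _ => False

/-- Reducibility candidates. -/
structure IsCandidate (S : Set PTerm) : Prop where
  sn : ∀ π ∈ S, SN π
  closed : ∀ π ∈ S, ∀ π', Red π π' → π' ∈ S
  neutral : ∀ π, Neutral π → (∀ π', Red1 π π' → π' ∈ S) → π ∈ S

/-- A pre-model is an assignment of a reducibility candidate to each atom. -/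
def IsPreModel (M : ℕ → Set PTerm) : Prop := ∀ P, IsCandidate (M P)

/-- The interpretation |A| of a formula in a pre-model. -/
def interp (M : ℕ → Set PTerm) : Form → Set PTerm
  | .atom P => M P
  | .bot => {π | SN π}
  | .imp A B => {π | SN π ∧ ∀ π₁, Red π (.lam π₁) →
      ∀ π' ∈ interp M A, subst 0 π' π₁ ∈ interp M B}
  | .and A B => {π | SN π ∧ ∀ π₁ π₂, Red π (.pair π₁ π₂) →
      π₁ ∈ interp M A ∧ π₂ ∈ interp M B}
  | .or A B => {π | SN π ∧ (∀ π₁, Red π (.inl π₁) → π₁ ∈ interp M A) ∧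
      (∀ π₂, Red π (.inr π₂) → π₂ ∈ interp M B)}

/-- A pre-model of a polarized rewrite system R. -/
def IsPreModelOf (R : PRS) (M : ℕ → Set PTerm) : Prop :=
  IsPreModel M ∧
  (∀ P A, R.neg P A → interp M (.atom P) ⊆ interp M A) ∧
  (∀ P A, R.pos P A → interp M A ⊆ interp M (.atom P))

/-- Extension of a renaming under a binder. -/
def upRen (ξ : ℕ → ℕ) : ℕ → ℕ
  | 0 => 0
  | n + 1 => ξ n + 1

/-- Renaming of the variables of a proof-term. -/
def ren (ξ : ℕ → ℕ) : PTerm → PTerm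
  | .var n => .var (ξ n)
  | .lam a => .lam (ren (upRen ξ) a)
  | .app a b => .app (ren ξ a) (ren ξ b)
  | .pair a b => .pair (ren ξ a) (ren ξ b)
  | .fst a => .fst (ren ξ a)
  | .snd a => .snd (ren ξ a)
  | .inl a => .inl (ren ξ a)
  | .inr a => .inr (ren ξ a)
  | .case a b c => .case (ren ξ a) (ren (upRen ξ) b) (ren (upRen ξ) c)
  | .exf a => .exf (ren ξ a)

/-- Extension of a parallel substitution under a binder. -/
def up (σ : ℕ → PTerm) : ℕ → PTerm
  | 0 => .var 0
  | n + 1 => ren Nat.succ (σ n)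

/-- Parallel substitution. -/
def inst (σ : ℕ → PTerm) : PTerm → PTerm
  | .var n => σ n
  | .lam a => .lam (inst (up σ) a)
  | .app a b => .app (inst σ a) (inst σ b)
  | .pair a b => .pair (inst σ a) (inst σ b)
  | .fst a => .fst (inst σ a)
  | .snd a => .snd (inst σ a)
  | .inl a => .inl (inst σ a)
  | .inr a => .inr (inst σ a)
  | .case a b c => .case (inst σ a) (inst (up σ) b) (inst (up σ) c)
  | .exf a => .exf (inst σ a)

/-- The substitution mapping `0` to `u` and `n + 1` to `σ n`. -/
def scons (u : PTerm) (σ : ℕ → PTerm) : ℕ → PTerm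
  | 0 => u
  | n + 1 => σ n

theorem upRen_comp (ξ ζ : ℕ → ℕ) : upRen ζ ∘ upRen ξ = upRen (ζ ∘ ξ) := by
  funext n; cases n <;> rfl

theorem ren_ren (t : PTerm) : ∀ ξ ζ, ren ζ (ren ξ t) = ren (ζ ∘ ξ) t := by
  induction t <;> intro ξ ζ <;> simp_all [ren, upRen_comp]

theorem up_comp_upRen (ξ : ℕ → ℕ) (σ : ℕ → PTerm) : up σ ∘ upRen ξ = up (σ ∘ ξ) := by
  funext n; cases n <;> rfl

theorem inst_ren (t : PTerm) : ∀ ξ σ, inst σ (ren ξ t) = inst (σ ∘ ξ) t := by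
  induction t <;> intro ξ σ <;> simp_all [ren, inst, up_comp_upRen]

theorem ren_comp_up (ξ : ℕ → ℕ) (σ : ℕ → PTerm) :
    ren (upRen ξ) ∘ up σ = up (ren ξ ∘ σ) := by
  funext n
  cases n with
  | zero => rfl
  | succ n =>
    simp only [Function.comp, up, ren_ren]
    rfl

theorem ren_inst (t : PTerm) : ∀ σ ξ, ren ξ (inst σ t) = inst (ren ξ ∘ σ) t := by
  induction t <;> intro σ ξ <;> simp_all [ren, inst, ren_comp_up]

theorem inst_comp_up (σ τ : ℕ → PTerm) : inst (up τ) ∘ up σ = up (inst τ ∘ σ) := by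
  funext n
  cases n with
  | zero => rfl
  | succ n =>
    simp only [Function.comp, up, inst_ren, ren_inst]
    rfl

theorem inst_inst (t : PTerm) : ∀ σ τ, inst τ (inst σ t) = inst (inst τ ∘ σ) t := by
  induction t <;> intro σ τ <;> simp_all [inst, inst_comp_up]

theorem up_var : up PTerm.var = PTerm.var := by
  funext n; cases n <;> rfl

theorem inst_var (t : PTerm) : inst PTerm.var t = t := by
  induction t <;> simp_all [inst, up_var]

theorem liftAbove_eq_ren (t : PTerm) :
    ∀ c, liftAbove c t = ren (fun n => if n < c then n else n + 1) t := by
  have h : ∀ c, upRen (fun n => if n < c then n else n + 1) =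
      fun n => if n < c + 1 then n else n + 1 := by
    intro c
    funext n
    cases n with
    | zero => simp [upRen]
    | succ n => by_cases hn : n < c <;> simp [upRen, hn]
  induction t with
  | var n => intro c; by_cases hn : n < c <;> simp [liftAbove, ren, hn]
  | _ => intro c; simp_all [liftAbove, ren]

theorem liftAbove_zero (t : PTerm) : liftAbove 0 t = ren Nat.succ t := by
  rw [liftAbove_eq_ren]; simp

theorem subst_eq_inst (t : PTerm) : ∀ k u, subst k u t =
    inst (fun n => if n < k then .var n else if n = k then u else .var (n - 1)) t := by
  have h : ∀ k u, up (fun n => if n < k then .var n else if n = k then u else .var (n - 1)) =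
      fun n => if n < k + 1 then .var n else if n = k + 1 then liftAbove 0 u
        else .var (n - 1) := by
    intro k u
    funext n
    cases n with
    | zero => simp [up]
    | succ n =>
      by_cases hn : n < k
      · simp [up, hn, ren]
      · by_cases hk : n = k
        · simp [up, hk, liftAbove_zero]
        · have : n - 1 + 1 = n := by omega
          simp [up, hn, hk, ren, this]
  induction t with
  | var n => intro k u; simp [subst, inst]
  | _ => intro k u; simp_all [subst, inst]

theorem subst_zero (u t : PTerm) : subst 0 u t = inst (scons u .var) t := by
  rw [subst_eq_inst]
  congr 1
  funext n
  cases n <;> simp [scons]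

theorem subst_inst_up (σ : ℕ → PTerm) (u t : PTerm) :
    subst 0 u (inst (up σ) t) = inst (scons u σ) t := by
  rw [subst_zero, inst_inst]
  congr 1
  funext n
  cases n with
  | zero => rfl
  | succ n =>
    simp only [Function.comp, up, inst_ren, scons]
    exact inst_var _

theorem inst_subst (σ : ℕ → PTerm) (u t : PTerm) :
    inst σ (subst 0 u t) = subst 0 (inst σ u) (inst (up σ) t) := by
  rw [subst_inst_up, subst_zero, inst_inst]
  congr 1
  funext n
  cases n <;> rfl

theorem Red1.inst {t t' : PTerm} (h : Red1 t t') : ∀ σ, Red1 (inst σ t) (inst σ t') := by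
  induction h <;> intro σ
  case beta => rw [inst_subst]; exact .beta
  case caseInl => rw [inst_subst]; exact .caseInl
  case caseInr => rw [inst_subst]; exact .caseInr
  all_goals constructor
  all_goals solve_by_elim

theorem Red1.subst {t t' : PTerm} (h : Red1 t t') (u : PTerm) :
    Red1 (subst 0 u t) (subst 0 u t') := by
  rw [subst_zero, subst_zero]; exact h.inst _

theorem Red.subst {t t' : PTerm} (h : Red t t') (u : PTerm) :
    Red (subst 0 u t) (subst 0 u t') := by
  induction h with
  | refl => exact .refl
  | tail _ r ih => exact ih.tail (r.subst u)

theorem SN.red {t t' : PTerm} (h : SN t) (r : Red t t') : SN t' := by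
  induction r with
  | refl => exact h
  | tail _ r ih => exact ih.inv r

theorem SN.of_map {f : PTerm → PTerm} (hf : ∀ t t', Red1 t t' → Red1 (f t) (f t'))
    {t : PTerm} (h : SN (f t)) : SN t :=
  Subrelation.accessible (r := InvImage (fun x y => Red1 y x) f) (fun h => hf _ _ h)
    (InvImage.accessible f h)

theorem SN.lam {t : PTerm} (h : SN t) : SN (.lam t) := by
  induction h with
  | intro t _ ih => exact ⟨_, fun _ r => by cases r with | lam r => exact ih _ r⟩

theorem SN.inl {t : PTerm} (h : SN t) : SN (.inl t) := by
  induction h with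
  | intro t _ ih => exact ⟨_, fun _ r => by cases r with | inl r => exact ih _ r⟩

theorem SN.inr {t : PTerm} (h : SN t) : SN (.inr t) := by
  induction h with
  | intro t _ ih => exact ⟨_, fun _ r => by cases r with | inr r => exact ih _ r⟩

theorem SN.pair {t u : PTerm} (h : SN t) (hu : SN u) : SN (.pair t u) := by
  induction h generalizing u with
  | intro t _ ih =>
    induction hu with
    | intro u hu ihu =>
      refine ⟨_, fun _ r => ?_⟩
      cases r with
      | pairL r => exact ih _ r ⟨_, hu⟩
      | pairR r => exact ihu _ r

theorem Red.lam_inv {t s : PTerm} (h : Red (.lam t) s) : ∃ t', s = .lam t' ∧ Red t t' := by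
  induction h with
  | refl => exact ⟨_, rfl, .refl⟩
  | tail _ r ih =>
    obtain ⟨t', rfl, h⟩ := ih
    cases r with
    | lam r => exact ⟨_, rfl, h.tail r⟩

theorem Red.inl_inv {t s : PTerm} (h : Red (.inl t) s) : ∃ t', s = .inl t' ∧ Red t t' := by
  induction h with
  | refl => exact ⟨_, rfl, .refl⟩
  | tail _ r ih =>
    obtain ⟨t', rfl, h⟩ := ih
    cases r with
    | inl r => exact ⟨_, rfl, h.tail r⟩

theorem Red.inr_inv {t s : PTerm} (h : Red (.inr t) s) : ∃ t', s = .inr t' ∧ Red t t' := by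
  induction h with
  | refl => exact ⟨_, rfl, .refl⟩
  | tail _ r ih =>
    obtain ⟨t', rfl, h⟩ := ih
    cases r with
    | inr r => exact ⟨_, rfl, h.tail r⟩

theorem Red.pair_inv {t u s : PTerm} (h : Red (.pair t u) s) :
    ∃ t' u', s = .pair t' u' ∧ Red t t' ∧ Red u u' := by
  induction h with
  | refl => exact ⟨_, _, rfl, .refl, .refl⟩
  | tail _ r ih =>
    obtain ⟨t', u', rfl, h, hu⟩ := ih
    cases r with
    | pairL r => exact ⟨_, _, rfl, h.tail r, hu⟩
    | pairR r => exact ⟨_, _, rfl, h, hu.tail r⟩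

theorem Neutral.red_head {t s : PTerm} (hn : Neutral t) (h : Red t s) (hs : ¬ Neutral s) :
    ∃ t', Red1 t t' ∧ Red t' s := by
  rcases h.cases_head with rfl | h
  · exact absurd hn hs
  · exact h

theorem isCandidate_SN : IsCandidate {π | SN π} where
  sn _ h := h
  closed _ h _ r := SN.red h r
  neutral _ _ h := ⟨_, h⟩

theorem isCandidate_interp {M : ℕ → Set PTerm} (hM : IsPreModel M) :
    ∀ A, IsCandidate (interp M A) := by
  intro A
  induction A with
  | atom P => exact hM P
  | bot => exact isCandidate_SN
  | imp A B ihA ihB =>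
    refine ⟨fun _ h => h.1, fun _ h _ r => ⟨h.1.red r, fun _ r' => h.2 _ (r.trans r')⟩, ?_⟩
    refine fun t hn h => ⟨⟨_, fun _ r => (h _ r).1⟩, fun _ r => ?_⟩
    obtain ⟨_, r₁, r₂⟩ := hn.red_head r not_false
    exact (h _ r₁).2 _ r₂
  | and A B ihA ihB =>
    refine ⟨fun _ h => h.1, fun _ h _ r => ⟨h.1.red r, fun _ _ r' => h.2 _ _ (r.trans r')⟩, ?_⟩
    refine fun t hn h => ⟨⟨_, fun _ r => (h _ r).1⟩, fun _ _ r => ?_⟩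
    obtain ⟨_, r₁, r₂⟩ := hn.red_head r not_false
    exact (h _ r₁).2 _ _ r₂
  | or A B ihA ihB =>
    refine ⟨fun _ h => h.1, fun _ h _ r => ⟨h.1.red r, fun _ r' => h.2.1 _ (r.trans r'),
      fun _ r' => h.2.2 _ (r.trans r')⟩, ?_⟩
    refine fun t hn h => ⟨⟨_, fun _ r => (h _ r).1⟩, fun _ r => ?_, fun _ r => ?_⟩
    · obtain ⟨_, r₁, r₂⟩ := hn.red_head r not_false
      exact (h _ r₁).2.1 _ r₂
    · obtain ⟨_, r₁, r₂⟩ := hn.red_head r not_false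
      exact (h _ r₁).2.2 _ r₂

namespace IsCandidate

variable {S : Set PTerm}

theorem var_mem (hS : IsCandidate S) (n : ℕ) : .var n ∈ S :=
  hS.neutral _ trivial fun _ r => nomatch r

theorem app_mem (hS : IsCandidate S) {a b : PTerm} (ha : SN a) (hb : SN b)
    (h : ∀ b', Red b b' → ∀ t, Red a (.lam t) → subst 0 b' t ∈ S) : .app a b ∈ S := by
  induction ha generalizing b with
  | intro a ha iha =>
    induction hb with
    | intro b hb ihb =>
      refine hS.neutral _ trivial fun s r => ?_
      cases r with
      | beta => exact h _ .refl _ .refl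
      | appL r => exact iha _ r ⟨_, hb⟩ fun b' rb t rt => h b' rb t (rt.head r)
      | appR r => exact ihb _ r fun b' rb t rt => h b' (rb.head r) t rt

theorem fst_mem (hS : IsCandidate S) {a : PTerm} (ha : SN a)
    (h : ∀ t u, Red a (.pair t u) → t ∈ S) : .fst a ∈ S := by
  induction ha with
  | intro a ha iha =>
    refine hS.neutral _ trivial fun s r => ?_
    cases r with
    | fstPair => exact h _ _ .refl
    | fst r => exact iha _ r fun t u rt => h t u (rt.head r)

theorem snd_mem (hS : IsCandidate S) {a : PTerm} (ha : SN a)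
    (h : ∀ t u, Red a (.pair t u) → u ∈ S) : .snd a ∈ S := by
  induction ha with
  | intro a ha iha =>
    refine hS.neutral _ trivial fun s r => ?_
    cases r with
    | sndPair => exact h _ _ .refl
    | snd r => exact iha _ r fun t u rt => h t u (rt.head r)

theorem exf_mem (hS : IsCandidate S) {a : PTerm} (ha : SN a) : .exf a ∈ S := by
  induction ha with
  | intro a ha iha =>
    refine hS.neutral _ trivial fun s r => ?_
    cases r with
    | exf r => exact iha _ r

theorem case_mem (hS : IsCandidate S) {a b c : PTerm} (ha : SN a) (hb : SN b) (hc : SN c)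
    (hl : ∀ t, Red a (.inl t) → subst 0 t b ∈ S)
    (hr : ∀ t, Red a (.inr t) → subst 0 t c ∈ S) : .case a b c ∈ S := by
  induction ha generalizing b c with
  | intro a ha iha =>
    induction hb generalizing c with
    | intro b hb ihb =>
      induction hc with
      | intro c hc ihc =>
        refine hS.neutral _ trivial fun s r => ?_
        cases r with
        | caseInl => exact hl _ .refl
        | caseInr => exact hr _ .refl
        | case₁ r =>
          exact iha _ r ⟨_, hb⟩ ⟨_, hc⟩ (fun t rt => hl t (rt.head r))
            fun t rt => hr t (rt.head r)
        | case₂ r =>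
          exact ihb _ r ⟨_, hc⟩ (fun t rt => hS.closed _ (hl t rt) _ (.single (r.subst t))) hr
        | case₃ r =>
          exact ihc _ r fun t rt => hS.closed _ (hr t rt) _ (.single (r.subst t))

end IsCandidate

theorem interp_imp_mono {M : ℕ → Set PTerm} {A A' B B' : Form}
    (hA : interp M A' ⊆ interp M A) (hB : interp M B ⊆ interp M B') :
    interp M (.imp A B) ⊆ interp M (.imp A' B') :=
  fun _ h => ⟨h.1, fun _ r _ hu => hB (h.2 _ r _ (hA hu))⟩

theorem interp_and_mono {M : ℕ → Set PTerm} {A A' B B' : Form}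
    (hA : interp M A ⊆ interp M A') (hB : interp M B ⊆ interp M B') :
    interp M (.and A B) ⊆ interp M (.and A' B') :=
  fun _ h => ⟨h.1, fun _ _ r => ⟨hA (h.2 _ _ r).1, hB (h.2 _ _ r).2⟩⟩

theorem interp_or_mono {M : ℕ → Set PTerm} {A A' B B' : Form}
    (hA : interp M A ⊆ interp M A') (hB : interp M B ⊆ interp M B') :
    interp M (.or A B) ⊆ interp M (.or A' B') :=
  fun _ h => ⟨h.1, fun _ r => hA (h.2.1 _ r), fun _ r => hB (h.2.2 _ r)⟩

namespace IsPreModelOf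

variable {R : PRS} {M : ℕ → Set PTerm}

mutual
theorem interp_neg1 (hM : IsPreModelOf R M) {A B : Form} :
    Neg1 R A B → interp M A ⊆ interp M B
  | .rule h => hM.2.1 _ _ h
  | .impL h => interp_imp_mono (interp_pos1 hM h) subset_rfl
  | .impR h => interp_imp_mono subset_rfl (interp_neg1 hM h)
  | .andL h => interp_and_mono (interp_neg1 hM h) subset_rfl
  | .andR h => interp_and_mono subset_rfl (interp_neg1 hM h)
  | .orL h => interp_or_mono (interp_neg1 hM h) subset_rfl
  | .orR h => interp_or_mono subset_rfl (interp_neg1 hM h)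

theorem interp_pos1 (hM : IsPreModelOf R M) {A B : Form} :
    Pos1 R A B → interp M B ⊆ interp M A
  | .rule h => hM.2.2 _ _ h
  | .impL h => interp_imp_mono (interp_neg1 hM h) subset_rfl
  | .impR h => interp_imp_mono subset_rfl (interp_pos1 hM h)
  | .andL h => interp_and_mono (interp_pos1 hM h) subset_rfl
  | .andR h => interp_and_mono subset_rfl (interp_pos1 hM h)
  | .orL h => interp_or_mono (interp_pos1 hM h) subset_rfl
  | .orR h => interp_or_mono subset_rfl (interp_pos1 hM h)
end

theorem interp_negR (hM : IsPreModelOf R M) {A B : Form} (h : NegR R A B) :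
    interp M A ⊆ interp M B := by
  induction h with
  | refl => exact subset_rfl
  | tail _ h ih => exact ih.trans (interp_neg1 hM h)

theorem interp_posR (hM : IsPreModelOf R M) {A B : Form} (h : PosR R A B) :
    interp M B ⊆ interp M A := by
  induction h with
  | refl => exact subset_rfl
  | tail _ h ih => exact (interp_pos1 hM h).trans ih

/-- Adequacy: instantiating a typed proof-term with reducible proof-terms yields a reducible
proof-term. -/
theorem inst_mem_interp (hM : IsPreModelOf R M) {Γ : List Form} {π : PTerm} {A : Form}
    (h : Typed R Γ π A) : ∀ σ : ℕ → PTerm,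
      (∀ n B, Γ[n]? = some B → σ n ∈ interp M B) → inst σ π ∈ interp M A := by
  have hC := isCandidate_interp hM.1
  have hcons : ∀ {Γ : List Form} {σ : ℕ → PTerm} {A u},
      (∀ n B, Γ[n]? = some B → σ n ∈ interp M B) → u ∈ interp M A →
      ∀ n B, (A :: Γ)[n]? = some B → scons u σ n ∈ interp M B := by
    intro Γ σ A u hσ hu n B hn
    cases n with
    | zero =>
      obtain rfl : A = B := by simpa using hn
      exact hu
    | succ n => exact hσ n B (by simpa using hn)
  have hbody : ∀ {Γ : List Form} {σ : ℕ → PTerm} {A B π},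
      (∀ τ : ℕ → PTerm, (∀ n C, (A :: Γ)[n]? = some C → τ n ∈ interp M C) →
        inst τ π ∈ interp M B) →
      (∀ n C, Γ[n]? = some C → σ n ∈ interp M C) →
      SN (inst (up σ) π) ∧ ∀ u ∈ interp M A, subst 0 u (inst (up σ) π) ∈ interp M B := by
    intro Γ σ A B π ih hσ
    have hu : ∀ u ∈ interp M A, subst 0 u (inst (up σ) π) ∈ interp M B := by
      intro u hu
      rw [subst_inst_up]
      exact ih _ (hcons hσ hu)
    exact ⟨SN.of_map (f := subst 0 (.var 0)) (fun _ _ r => r.subst _)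
      ((hC B).sn _ (hu _ ((hC A).var_mem 0))), hu⟩
  induction h with
  | ax hn hA hB =>
    intro σ hσ
    exact hM.interp_posR hB (hM.interp_negR hA (hσ _ _ hn))
  | @impI Γ π A B C _ hP ih =>
    intro σ hσ
    obtain ⟨hsn, hs⟩ := hbody ih hσ
    refine hM.interp_posR hP ⟨hsn.lam, fun t r u hu => ?_⟩
    obtain ⟨_, ⟨⟩, r⟩ := r.lam_inv
    exact (hC B).closed _ (hs u hu) _ (r.subst u)
  | impE _ hN _ ih₁ ih₂ =>
    intro σ hσ
    have h₁ := hM.interp_negR hN (ih₁ σ hσ)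
    have h₂ := ih₂ σ hσ
    exact (hC _).app_mem h₁.1 ((hC _).sn _ h₂)
      fun b' rb t rt => h₁.2 t rt b' ((hC _).closed _ h₂ _ rb)
  | andI _ _ hP ih₁ ih₂ =>
    intro σ hσ
    have h₁ := ih₁ σ hσ
    have h₂ := ih₂ σ hσ
    refine hM.interp_posR hP ⟨((hC _).sn _ h₁).pair ((hC _).sn _ h₂), fun t u r => ?_⟩
    obtain ⟨_, _, ⟨⟩, r₁, r₂⟩ := r.pair_inv
    exact ⟨(hC _).closed _ h₁ _ r₁, (hC _).closed _ h₂ _ r₂⟩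
  | andE₁ _ hN ih =>
    intro σ hσ
    have h := hM.interp_negR hN (ih σ hσ)
    exact (hC _).fst_mem h.1 fun t u r => (h.2 t u r).1
  | andE₂ _ hN ih =>
    intro σ hσ
    have h := hM.interp_negR hN (ih σ hσ)
    exact (hC _).snd_mem h.1 fun t u r => (h.2 t u r).2
  | orI₁ _ hP ih =>
    intro σ hσ
    have h := ih σ hσ
    refine hM.interp_posR hP ⟨((hC _).sn _ h).inl, fun t r => ?_, fun t r => ?_⟩
    · obtain ⟨_, ⟨⟩, r⟩ := r.inl_inv
      exact (hC _).closed _ h _ r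
    · obtain ⟨_, ⟨⟩, _⟩ := r.inl_inv
  | orI₂ _ hP ih =>
    intro σ hσ
    have h := ih σ hσ
    refine hM.interp_posR hP ⟨((hC _).sn _ h).inr, fun t r => ?_, fun t r => ?_⟩
    · obtain ⟨_, ⟨⟩, _⟩ := r.inr_inv
    · obtain ⟨_, ⟨⟩, r⟩ := r.inr_inv
      exact (hC _).closed _ h _ r
  | orE _ hN _ _ ih₁ ih₂ ih₃ =>
    intro σ hσ
    have h := hM.interp_negR hN (ih₁ σ hσ)
    obtain ⟨hsn₂, hs₂⟩ := hbody ih₂ hσ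
    obtain ⟨hsn₃, hs₃⟩ := hbody ih₃ hσ
    exact (hC _).case_mem h.1 hsn₂ hsn₃ (fun t r => hs₂ _ (h.2.1 t r))
      fun t r => hs₃ _ (h.2.2 t r)
  | botE _ hN ih =>
    intro σ hσ
    exact (hC _).exf_mem (hM.interp_negR hN (ih σ hσ))

theorem sn (hM : IsPreModelOf R M) {Γ : List Form} {π : PTerm} {A : Form}
    (h : Typed R Γ π A) : SN π := by
  have hC := isCandidate_interp hM.1
  have := hM.inst_mem_interp h .var fun n B _ => (hC B).var_mem n
  rw [inst_var] at this
  exact (hC A).sn _ this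

end IsPreModelOf

/-- The least reducibility candidate. -/
def leastCandidate : Set PTerm := {π | ∀ S, IsCandidate S → π ∈ S}

theorem isCandidate_leastCandidate : IsCandidate leastCandidate where
  sn _ h := h _ isCandidate_SN
  closed _ h _ r S hS := hS.closed _ (h S hS) _ r
  neutral _ hn h S hS := hS.neutral _ hn fun _ r => h _ r S hS

open Classical in
/-- Atoms with a negative rule are interpreted by the least candidate, all others by the
greatest one. -/
noncomputable def extremalPreModel (R : PRS) (P : ℕ) : Set PTerm :=
  if ∃ A, R.neg P A then leastCandidate else {π | SN π}

theorem isPreModelOf_extremalPreModel (R : PRS)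
    (hdisj : ∀ P, ¬ ((∃ A, R.neg P A) ∧ (∃ A, R.pos P A))) :
    IsPreModelOf R (extremalPreModel R) := by
  have hM : IsPreModel (extremalPreModel R) := by
    intro P
    unfold extremalPreModel
    split_ifs
    · exact isCandidate_leastCandidate
    · exact isCandidate_SN
  refine ⟨hM, fun P A h π hπ => ?_, fun P A h π hπ => ?_⟩
  · have hP : ∃ A, R.neg P A := ⟨A, h⟩
    simp only [interp, extremalPreModel, if_pos hP] at hπ
    exact hπ _ (isCandidate_interp hM A)
  · have hP : ¬ ∃ A, R.neg P A := fun hP => hdisj P ⟨hP, A, h⟩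
    simp only [interp, extremalPreModel, if_neg hP]
    exact (isCandidate_interp hM A).sn _ hπ

/-- If no atomic proposition is both the left-hand side of a negative rule and
the left-hand side of a positive rule, then every proof-term of Γ ⊢_R A is
strongly normalizable. -/
theorem sn_of_disjoint_lhs (R : PRS)
    (hdisj : ∀ P, ¬ ((∃ A, R.neg P A) ∧ (∃ A, R.pos P A)))
    (Γ : List Form) (π : PTerm) (A : Form)
    (h : Typed R Γ π A) :
    SN π := by
  exact (isPreModelOf_extremalPreModel R hdisj).sn h
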